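/- Let g̃ : S → ℝ be continuously differentiable, let ρᵈ : ℝ≥0 × S → ℝ be continuously differentiable, and let e : ℝ≥0 × S → ℝ be a continuously differentiable solution (C¹ in t, C² in x) of e_t = −K_p e + [e Ũᵈ]_x + [ρᵈ Ũᵉ]_x − [e Ũᵉ]_x, where Ũᵈ(t,·) = g̃ * ρᵈ(t,·) and Ũᵉ(t,·) = g̃ * e(t,·). Then for all t ≥ 0, the time derivative of ‖e(t,·)‖₂² equals −2K_p ‖e(t,·)‖₂² + ∫_S e(t,x)² Ũᵈ_x(t,x) dx − ∫_S e(t,x)² Ũᵉ_x(t,x) dx + 2∫_S ( e(t,x) ρᵈ_x(t,x) Ũᵉ(t,x) + e(t,x) ρᵈ(t,x) Ũᵉ_x(t,x) ) dx. -/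

import Mathlib

open MeasureTheory Real Filter

/-- Circular convolution on `S = [-π, π]`. -/
noncomputable def circConv (f g : ℝ → ℝ) : ℝ → ℝ :=
  fun x => ∫ y in (-Real.pi)..Real.pi, f (x - y) * g y

/-- Differentiation under the integral sign over a compact interval, with a jointly continuous
partial derivative. -/
theorem hasDerivAt_intervalIntegral_of_continuous {F F' : ℝ → ℝ → ℝ} {a b : ℝ}
    (hF : ∀ t, Continuous (F t)) (hF' : Continuous (fun p : ℝ × ℝ => F' p.1 p.2))
    (h : ∀ t x, HasDerivAt (fun τ => F τ x) (F' t x) t) (t : ℝ) :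
    HasDerivAt (fun τ => ∫ x in a..b, F τ x) (∫ x in a..b, F' t x) t := by
  obtain ⟨C, hC⟩ := ((isCompact_closedBall t 1).prod
    (isCompact_uIcc (a := a) (b := b))).exists_bound_of_continuousOn hF'.continuousOn
  have hsec : Continuous (F' t) := hF'.comp (by fun_prop : Continuous fun x : ℝ => (t, x))
  refine (intervalIntegral.hasDerivAt_integral_of_dominated_loc_of_deriv_le (bound := fun _ => C)
    (Metric.ball_mem_nhds t one_pos)
    (Eventually.of_forall fun τ => (hF τ).aestronglyMeasurable)
    ((hF t).intervalIntegrable a b) hsec.aestronglyMeasurable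
    (Eventually.of_forall fun x hx τ hτ => ?_) intervalIntegrable_const
    (Eventually.of_forall fun x _ τ _ => h τ x)).2
  exact hC (τ, x) ⟨Metric.ball_subset_closedBall hτ, Set.uIoc_subset_uIcc hx⟩

/-- The circular convolution of a `C¹` kernel with a continuous function is differentiable. -/
theorem hasDerivAt_circConv {g f : ℝ → ℝ} (hg : ContDiff ℝ 1 g) (hf : Continuous f) (x : ℝ) :
    HasDerivAt (circConv g f) (circConv (deriv g) f x) x := by
  have hg' : Continuous (deriv g) := hg.continuous_deriv le_rfl
  have hgc : Continuous g := hg.continuous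
  refine hasDerivAt_intervalIntegral_of_continuous (F := fun x y => g (x - y) * f y)
    (F' := fun x y => deriv g (x - y) * f y) (fun x => by fun_prop) (by fun_prop)
    (fun x y => ?_) x
  exact (((hg.differentiable one_ne_zero (x - y)).hasDerivAt).comp_sub_const x y).mul_const (f y)

theorem continuous_circConv {g f : ℝ → ℝ} (hg : Continuous g) (hf : Continuous f) :
    Continuous (circConv g f) :=
  intervalIntegral.continuous_parametric_intervalIntegral_of_continuous'
    (f := fun x y => g (x - y) * f y) (by unfold Function.uncurry; fun_prop) _ _

theorem periodic_circConv {g f : ℝ → ℝ} {c : ℝ} (hg : Function.Periodic g c) :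
    Function.Periodic (circConv g f) c := fun x => by
  simp only [circConv]
  congr 1
  ext y
  rw [add_sub_right_comm, hg]

/-- The derivative of a periodic function integrates to zero over a period. -/
theorem integral_deriv_eq_zero_of_periodic {f f' : ℝ → ℝ}
    (hper : Function.Periodic f (2 * Real.pi)) (h : ∀ x, HasDerivAt f (f' x) x)
    (hf' : Continuous f') : ∫ x in (-Real.pi)..Real.pi, f' x = 0 := by
  rw [intervalIntegral.integral_eq_sub_of_hasDerivAt (fun x _ => h x)
    (hf'.intervalIntegrable _ _), ← hper (-Real.pi), sub_eq_zero]
  congr 1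
  ring

/-- **Equation (31) of the paper.** Differentiating `‖e(t,·)‖₂²` along the error
dynamics with a perturbed kernel, with `Ũᵈ(t,·) = g̃ * ρᵈ(t,·)` and `Ũᵉ(t,·) = g̃ * e(t,·)`. -/
theorem norm_sq_derivative_kernel_perturbation
    (gTilde : ℝ → ℝ) (hg : ContDiff ℝ 1 gTilde)
    (hgper : Function.Periodic gTilde (2 * Real.pi))
    (ρd : ℝ → ℝ → ℝ)
    (hρd : ContDiff ℝ 1 (fun p : ℝ × ℝ => ρd p.1 p.2))
    (hρdper : ∀ t, Function.Periodic (ρd t) (2 * Real.pi))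
    (Kp : ℝ)
    (e : ℝ → ℝ → ℝ)
    (he1 : ContDiff ℝ 1 (fun p : ℝ × ℝ => e p.1 p.2))
    (he2 : ∀ t, ContDiff ℝ 2 (e t))
    (heper : ∀ t, Function.Periodic (e t) (2 * Real.pi))
    (hdyn : ∀ t, 0 ≤ t → ∀ x : ℝ,
      HasDerivAt (fun τ => e τ x)
        (-Kp * e t x
          + deriv (fun y => e t y * circConv gTilde (ρd t) y) x
          + deriv (fun y => ρd t y * circConv gTilde (e t) y) x
          - deriv (fun y => e t y * circConv gTilde (e t) y) x) t) :
    ∀ t, 0 ≤ t →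
      HasDerivAt (fun τ => ∫ x in (-Real.pi)..Real.pi, e τ x ^ 2)
        (-2 * Kp * (∫ x in (-Real.pi)..Real.pi, e t x ^ 2)
          + (∫ x in (-Real.pi)..Real.pi, e t x ^ 2 * deriv (circConv gTilde (ρd t)) x)
          - (∫ x in (-Real.pi)..Real.pi, e t x ^ 2 * deriv (circConv gTilde (e t)) x)
          + 2 * ∫ x in (-Real.pi)..Real.pi,
              (e t x * deriv (ρd t) x * circConv gTilde (e t) x
                + e t x * ρd t x * deriv (circConv gTilde (e t)) x)) t := by
  intro t ht
  have hec : Continuous (e t) := (he2 t).continuous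
  have hed (x : ℝ) : HasDerivAt (e t) (deriv (e t) x) x :=
    ((he2 t).differentiable two_ne_zero x).hasDerivAt
  have hec' : Continuous (deriv (e t)) := (he2 t).continuous_deriv one_le_two
  have hρ : ContDiff ℝ 1 (ρd t) := hρd.comp (contDiff_const.prodMk contDiff_id)
  have hρc : Continuous (ρd t) := hρ.continuous
  have hρd' (x : ℝ) : HasDerivAt (ρd t) (deriv (ρd t) x) x :=
    (hρ.differentiable one_ne_zero x).hasDerivAt
  have hρc' : Continuous (deriv (ρd t)) := hρ.continuous_deriv le_rfl
  have hg' : Continuous (deriv gTilde) := hg.continuous_deriv le_rfl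
  have hU := hasDerivAt_circConv hg hρc
  have hV := hasDerivAt_circConv hg hec
  have hUc := continuous_circConv hg.continuous hρc
  have hVc := continuous_circConv hg.continuous hec
  have hUc' := continuous_circConv hg' hρc
  have hVc' := continuous_circConv hg' hec
  have hUper := periodic_circConv (f := ρd t) hgper
  have hVper := periodic_circConv (f := e t) hgper
  have hdt (τ x : ℝ) : HasDerivAt (fun s => e s x)
      (fderiv ℝ (fun p : ℝ × ℝ => e p.1 p.2) (τ, x) (1, 0)) τ :=
    HasFDerivAt.comp_hasDerivAt (f := fun s => (s, x)) τ
      (he1.differentiable one_ne_zero (τ, x)).hasFDerivAt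
      ((hasDerivAt_id τ).prodMk (hasDerivAt_const τ x))
  have hdtc : Continuous fun p : ℝ × ℝ =>
      fderiv ℝ (fun p : ℝ × ℝ => e p.1 p.2) (p.1, p.2) (1, 0) :=
    (he1.continuous_fderiv one_ne_zero).clm_apply continuous_const
  have hmain := hasDerivAt_intervalIntegral_of_continuous (a := -Real.pi) (b := Real.pi)
    (F := fun τ x => e τ x ^ 2)
    (F' := fun τ x => 2 * e τ x * fderiv ℝ (fun p : ℝ × ℝ => e p.1 p.2) (τ, x) (1, 0))
    (fun τ => (he2 τ).continuous.pow 2)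
    ((continuous_const.mul he1.continuous).mul hdtc)
    (fun τ x => by simpa using (hdt τ x).fun_pow 2) t
  have hboundary := integral_deriv_eq_zero_of_periodic
    (f := fun x => e t x ^ 2 * (circConv gTilde (ρd t) x - circConv gTilde (e t) x))
    (f' := fun x => 2 * e t x * deriv (e t) x
        * (circConv gTilde (ρd t) x - circConv gTilde (e t) x)
      + e t x ^ 2 * (circConv (deriv gTilde) (ρd t) x - circConv (deriv gTilde) (e t) x))
    (fun x => by simp only [heper t x, hUper x, hVper x])
    (fun x => by simpa using ((hed x).fun_pow 2).fun_mul ((hU x).fun_sub (hV x)))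
    (by fun_prop)
  convert hmain using 1
  refine (sub_eq_zero.mp (Eq.trans ?_ hboundary)).symm
  simp only [(hU _).deriv, (hV _).deriv]
  rw [← intervalIntegral.integral_const_mul, ← intervalIntegral.integral_const_mul,
    ← intervalIntegral.integral_add, ← intervalIntegral.integral_sub,
    ← intervalIntegral.integral_add, ← intervalIntegral.integral_sub]
  · refine intervalIntegral.integral_congr fun x _ => ?_
    rw [(hdt t x).unique (hdyn t ht x), ((hed x).fun_mul (hU x)).deriv,
      ((hρd' x).fun_mul (hV x)).deriv, ((hed x).fun_mul (hV x)).deriv]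
    ring
  · exact ((continuous_const.mul hec).mul
      (hdtc.comp (by fun_prop : Continuous fun x : ℝ => (t, x)))).intervalIntegrable _ _
  all_goals exact Continuous.intervalIntegrable (by fun_prop) _ _
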